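/- arXiv:2305.00746 — 3 statements merged into one kernel-verified Lean document; each statement's English description precedes it below -/
import Mathlib

section
/- (Nonlinear estimate, term A₂ in Lemma 3.1.) Under the Setting, there exists a constant C > 0 such that for every u ∈ C_c^∞(ℝⁿ, ℂ), ‖ |x|^{−τ} |u|^{p−1} (I_α * (|·|^{−τ−1}|u|^p)) ‖_{L^{2n/(n+2)}(ℝⁿ)} ≤ C ‖∇u‖_{L^r(ℝⁿ)}^{2p−1}. -/
open MeasureTheory

section RieszPotential

open Set Metric Module
open scoped ENNReal

theorem lintegral_rpow_indicator_lt {e : ℝ} (he : 0 < e) (x : ℝ≥0∞) :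
    ∫⁻ s in Ioi (0 : ℝ), {s : ℝ | ENNReal.ofReal s < x}.indicator
      (fun s => ENNReal.ofReal (s ^ (e - 1))) s = ENNReal.ofReal (1 / e) * x ^ e := by
  have fin : ∀ N : ℝ, 0 ≤ N → ∫⁻ s in Ioi (0 : ℝ), {s : ℝ | s < N}.indicator
      (fun s => ENNReal.ofReal (s ^ (e - 1))) s = ENNReal.ofReal (1 / e) * ENNReal.ofReal N ^ e := by
    intro N hN
    have h := lintegral_rpow_eq_lintegral_meas_lt_mul (Measure.dirac ()) (f := fun _ => N)
      (Filter.Eventually.of_forall fun _ => hN) aemeasurable_const he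
    rw [lintegral_const, measure_univ, mul_one] at h
    rw [ENNReal.ofReal_rpow_of_nonneg hN he.le, h, ← mul_assoc,
      ← ENNReal.ofReal_mul (by positivity), one_div_mul_cancel he.ne', ENNReal.ofReal_one, one_mul]
    refine lintegral_congr fun s => ?_
    by_cases hs : s < N <;> simp [hs]
  induction x with
  | coe x =>
    have h := fin x x.2
    rw [ENNReal.ofReal_coe_nnreal] at h
    rw [← h]
    refine setLIntegral_congr_fun measurableSet_Ioi fun s hs => ?_
    simp only [indicator, mem_ofPred_eq, ← ENNReal.ofReal_coe_nnreal]
    simp only [ENNReal.ofReal_lt_ofReal_iff_of_nonneg (le_of_lt hs)]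
  | top =>
    rw [ENNReal.top_rpow_of_pos he, ENNReal.mul_top (by simpa using he)]
    refine ENNReal.eq_top_of_forall_nnreal_le fun r => ?_
    have hr : (0:ℝ) ≤ (e * r) ^ (1 / e) := by positivity
    have h := fin _ hr
    rw [ENNReal.ofReal_rpow_of_nonneg hr he.le, ← Real.rpow_mul (by positivity),
      one_div_mul_cancel he.ne', Real.rpow_one, ← ENNReal.ofReal_mul (by positivity), ← mul_assoc,
      one_div_mul_cancel he.ne', one_mul, ENNReal.ofReal_coe_nnreal] at h
    rw [← h]
    refine lintegral_mono fun s => ?_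
    refine indicator_le_indicator_of_subset ?_ (fun _ => zero_le) s
    intro s _
    simp

variable {E : Type*} [NormedAddCommGroup E] [NormedSpace ℝ E] [FiniteDimensional ℝ E]
  [MeasurableSpace E] [BorelSpace E] (μ : Measure E) [μ.IsAddHaarMeasure]

theorem lintegral_comp_smul_of_pos (f : E → ℝ≥0∞) {R : ℝ} (hR : 0 < R) :
    ∫⁻ x, f (R • x) ∂μ = ENNReal.ofReal (R ^ (-(finrank ℝ E : ℝ))) * ∫⁻ x, f x ∂μ := by
  have h := (Homeomorph.smulOfNeZero R hR.ne').toMeasurableEquiv.measurableEmbedding.lintegral_map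
    (μ := μ) f
  have e : ⇑(Homeomorph.smulOfNeZero R hR.ne').toMeasurableEquiv = fun x : E => R • x := rfl
  rw [e, Measure.map_addHaar_smul μ hR.ne', lintegral_smul_measure] at h
  rw [← h, Real.rpow_neg hR.le, Real.rpow_natCast, abs_of_pos (by positivity), smul_eq_mul]

theorem lintegral_eq_rpow_mul_of_homogeneous {s R : ℝ} (hR : 0 < R) (F G : E → ℝ≥0∞)
    (h : ∀ x, F (R • x) = ENNReal.ofReal (R ^ s) * G x) :
    ∫⁻ x, F x ∂μ = ENNReal.ofReal (R ^ (s + finrank ℝ E)) * ∫⁻ x, G x ∂μ := by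
  have h1 := lintegral_comp_smul_of_pos μ F hR
  simp_rw [h] at h1
  rw [lintegral_const_mul' _ _ ENNReal.ofReal_ne_top] at h1
  rw [Real.rpow_add hR, mul_comm (R ^ s), ENNReal.ofReal_mul (by positivity), mul_assoc, h1,
    ← mul_assoc, ← ENNReal.ofReal_mul (by positivity), ← Real.rpow_add hR]
  simp

theorem lintegral_ball_rpow_norm {s R : ℝ} (hR : 0 < R) :
    ∫⁻ x, (ball (0 : E) R).indicator (fun x => ENNReal.ofReal (‖x‖ ^ s)) x ∂μ =
      ENNReal.ofReal (R ^ (s + finrank ℝ E)) *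
        ∫⁻ x, (ball (0 : E) 1).indicator (fun x => ENNReal.ofReal (‖x‖ ^ s)) x ∂μ := by
  refine lintegral_eq_rpow_mul_of_homogeneous μ hR _ _ fun x => ?_
  have hb : R • x ∈ ball (0 : E) R ↔ x ∈ ball (0 : E) 1 := by
    simp [norm_smul, abs_of_pos hR, mul_lt_iff_lt_one_right hR]
  by_cases hx : x ∈ ball (0 : E) 1
  · rw [indicator_of_mem hx, indicator_of_mem (hb.2 hx), norm_smul, Real.norm_of_nonneg hR.le,
      Real.mul_rpow hR.le (norm_nonneg _), ENNReal.ofReal_mul (by positivity)]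
  · rw [indicator_of_notMem hx, indicator_of_notMem (hb.not.2 hx), mul_zero]

theorem lintegral_compl_ball_rpow_norm {s R : ℝ} (hR : 0 < R) :
    ∫⁻ x, (ball (0 : E) R)ᶜ.indicator (fun x => ENNReal.ofReal (‖x‖ ^ s)) x ∂μ =
      ENNReal.ofReal (R ^ (s + finrank ℝ E)) *
        ∫⁻ x, (ball (0 : E) 1)ᶜ.indicator (fun x => ENNReal.ofReal (‖x‖ ^ s)) x ∂μ := by
  refine lintegral_eq_rpow_mul_of_homogeneous μ hR _ _ fun x => ?_
  have hb : R • x ∈ (ball (0 : E) R)ᶜ ↔ x ∈ (ball (0 : E) 1)ᶜ := by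
    simp [norm_smul, abs_of_pos hR, le_mul_iff_one_le_right hR]
  by_cases hx : x ∈ (ball (0 : E) 1)ᶜ
  · rw [indicator_of_mem hx, indicator_of_mem (hb.2 hx), norm_smul, Real.norm_of_nonneg hR.le,
      Real.mul_rpow hR.le (norm_nonneg _), ENNReal.ofReal_mul (by positivity)]
  · rw [indicator_of_notMem hx, indicator_of_notMem (hb.not.2 hx), mul_zero]

theorem lintegral_ball_one_rpow_norm_ne_top [Nontrivial E] {s : ℝ} (hs : -(finrank ℝ E : ℝ) < s) :
    ∫⁻ x, (ball (0 : E) 1).indicator (fun x => ENNReal.ofReal (‖x‖ ^ s)) x ∂μ ≠ ∞ := by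
  have h := integrableOn_ball_of_norm_le_rpow (μ := μ) (f := fun x : E => ‖x‖ ^ s)
    (C := 1) (α := -s) (r := 1) finrank_pos (by linarith)
    (Filter.Eventually.of_forall fun x => by simp [abs_of_nonneg (Real.rpow_nonneg (norm_nonneg x) s)])
    (Measurable.aestronglyMeasurable (by fun_prop))
  have h2 := h.hasFiniteIntegral
  rw [lintegral_indicator measurableSet_ball]
  rw [hasFiniteIntegral_iff_ofReal (Filter.Eventually.of_forall fun x => by positivity)] at h2
  exact h2.ne

theorem lintegral_compl_ball_one_rpow_norm_ne_top [Nontrivial E] {s : ℝ}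
    (hs : s < -(finrank ℝ E : ℝ)) :
    ∫⁻ x, (ball (0 : E) 1)ᶜ.indicator (fun x => ENNReal.ofReal (‖x‖ ^ s)) x ∂μ ≠ ∞ := by
  have key : IntegrableOn
      (fun y : ℝ => y ^ (finrank ℝ E - 1) • (Ici 1).indicator (fun y : ℝ => y ^ s) y) (Ioi 0) := by
    have h1 : IntegrableOn (fun y : ℝ => y ^ (s + (finrank ℝ E - 1 : ℕ))) (Ici 1) := by
      rw [integrableOn_Ici_iff_integrableOn_Ioi]
      refine integrableOn_Ioi_rpow_of_lt ?_ one_pos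
      rw [Nat.cast_sub finrank_pos]
      push_cast
      linarith
    refine IntegrableOn.congr_fun
      (f := (Ici (1 : ℝ)).indicator (fun y : ℝ => y ^ (s + (finrank ℝ E - 1 : ℕ)))) ?_ ?_
      measurableSet_Ioi
    · exact ((integrable_indicator_iff measurableSet_Ici).2 h1).integrableOn
    · intro y hy
      by_cases hy1 : y ∈ Ici (1 : ℝ)
      · simp only [indicator_of_mem hy1, smul_eq_mul]
        rw [Real.rpow_add hy, Real.rpow_natCast, mul_comm]
      · simp [indicator_of_notMem hy1]
  rw [← integrable_fun_norm_addHaar μ (f := (Ici (1 : ℝ)).indicator (fun y : ℝ => y ^ s))] at key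
  have h2 := key.hasFiniteIntegral
  have nn : ∀ x : E, 0 ≤ (Ici (1 : ℝ)).indicator (fun y : ℝ => y ^ s) ‖x‖ := fun x =>
    indicator_nonneg (fun y hy => Real.rpow_nonneg (zero_le_one.trans hy) _) _
  rw [hasFiniteIntegral_iff_ofReal (Filter.Eventually.of_forall nn)] at h2
  refine (lt_of_le_of_lt (lintegral_mono fun x => ?_) h2).ne
  by_cases hx : x ∈ (ball (0 : E) 1)ᶜ
  · have : ‖x‖ ∈ Ici (1 : ℝ) := by simpa using hx
    simp [indicator_of_mem hx, indicator_of_mem this]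
  · simp [indicator_of_notMem hx]

theorem lintegral_lintegral_near_mul {α : ℝ} (μ : Measure E) [μ.IsAddHaarMeasure]
    {f : E → ℝ≥0∞} (hf : Measurable f) {R : ℝ} (hR : 0 < R) :
    ∫⁻ x, ∫⁻ y, (ball (0 : E) R).indicator
        (fun z => ENNReal.ofReal (‖z‖ ^ (α - finrank ℝ E))) (x - y) * f y ∂μ ∂μ =
      ENNReal.ofReal (R ^ α) * (∫⁻ z, (ball (0 : E) 1).indicator
        (fun z => ENNReal.ofReal (‖z‖ ^ (α - finrank ℝ E))) z ∂μ) * ∫⁻ y, f y ∂μ := by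
  have hK : Measurable ((ball (0 : E) R).indicator
      (fun z => ENNReal.ofReal (‖z‖ ^ (α - finrank ℝ E)))) :=
    Measurable.indicator (by fun_prop) measurableSet_ball
  rw [lintegral_lintegral_swap (by fun_prop)]
  have h : ∀ y, ∫⁻ x, (ball (0 : E) R).indicator
        (fun z => ENNReal.ofReal (‖z‖ ^ (α - finrank ℝ E))) (x - y) * f y ∂μ =
      ENNReal.ofReal (R ^ α) * (∫⁻ z, (ball (0 : E) 1).indicator
        (fun z => ENNReal.ofReal (‖z‖ ^ (α - finrank ℝ E))) z ∂μ) * f y := by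
    intro y
    rw [lintegral_mul_const _ (by fun_prop), lintegral_sub_right_eq_self
      (fun z => (ball (0 : E) R).indicator
        (fun z => ENNReal.ofReal (‖z‖ ^ (α - finrank ℝ E))) z) y,
      lintegral_ball_rpow_norm μ hR, sub_add_cancel]
  simp_rw [h]
  rw [lintegral_const_mul _ hf]

theorem lintegral_near_mul_const {α : ℝ} (μ : Measure E) [μ.IsAddHaarMeasure]
    {R : ℝ} (hR : 0 < R) (x : E) (c : ℝ≥0∞) :
    ∫⁻ y, (ball (0 : E) R).indicator
        (fun z => ENNReal.ofReal (‖z‖ ^ (α - finrank ℝ E))) (x - y) * c ∂μ =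
      ENNReal.ofReal (R ^ α) * (∫⁻ z, (ball (0 : E) 1).indicator
        (fun z => ENNReal.ofReal (‖z‖ ^ (α - finrank ℝ E))) z ∂μ) * c := by
  have hK : Measurable ((ball (0 : E) R).indicator
      (fun z => ENNReal.ofReal (‖z‖ ^ (α - finrank ℝ E)))) :=
    Measurable.indicator (by fun_prop) measurableSet_ball
  rw [lintegral_mul_const _ (by fun_prop), lintegral_sub_left_eq_self
      (fun z => (ball (0 : E) R).indicator
        (fun z => ENNReal.ofReal (‖z‖ ^ (α - finrank ℝ E))) z) x,
      lintegral_ball_rpow_norm μ hR, sub_add_cancel]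

theorem lintegral_far_mul_le {α a : ℝ} (ha : 1 < a) (μ : Measure E) [μ.IsAddHaarMeasure]
    {f : E → ℝ≥0∞} (hf : Measurable f) (hf1 : ∫⁻ y, f y ^ a ∂μ ≤ 1) {R : ℝ} (hR : 0 < R) (x : E) :
    ∫⁻ y, (ball (0 : E) R)ᶜ.indicator
        (fun z => ENNReal.ofReal (‖z‖ ^ (α - finrank ℝ E))) (x - y) * f y ∂μ ≤
      ENNReal.ofReal (R ^ (α - finrank ℝ E / a)) * (∫⁻ z, (ball (0 : E) 1)ᶜ.indicator
        (fun z => ENNReal.ofReal (‖z‖ ^ ((α - finrank ℝ E) / (1 - 1 / a)))) z ∂μ) ^ (1 - 1 / a) := by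
  have ha' : 0 < 1 - 1 / a := by
    rw [sub_pos, div_lt_one (by linarith)]; exact ha
  have hK : Measurable ((ball (0 : E) R)ᶜ.indicator
      (fun z => ENNReal.ofReal (‖z‖ ^ ((α - finrank ℝ E) / (1 - 1 / a))))) :=
    Measurable.indicator (by fun_prop) measurableSet_ball.compl
  have hol := ENNReal.lintegral_mul_norm_pow_le (μ := μ)
    (f := fun y => (ball (0 : E) R)ᶜ.indicator
      (fun z => ENNReal.ofReal (‖z‖ ^ ((α - finrank ℝ E) / (1 - 1 / a)))) (x - y))
    (g := fun y => f y ^ a) (by fun_prop) (by fun_prop) (p := 1 - 1 / a) (q := 1 / a)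
    ha'.le (by positivity) (by ring)
  calc _ = _ := lintegral_congr fun y => ?_
    _ ≤ _ := hol
    _ ≤ _ := ?_
  · rw [← ENNReal.rpow_mul, mul_one_div_cancel (by linarith), ENNReal.rpow_one]
    congr 1
    by_cases h : x - y ∈ (ball (0 : E) R)ᶜ
    · rw [indicator_of_mem h, indicator_of_mem h, ENNReal.ofReal_rpow_of_nonneg (by positivity) ha'.le,
        ← Real.rpow_mul (norm_nonneg _), div_mul_cancel₀ _ ha'.ne']
    · rw [indicator_of_notMem h, indicator_of_notMem h, ENNReal.zero_rpow_of_pos ha']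
  · rw [lintegral_sub_left_eq_self (fun z => (ball (0 : E) R)ᶜ.indicator
        (fun z => ENNReal.ofReal (‖z‖ ^ ((α - finrank ℝ E) / (1 - 1 / a)))) z) x,
      lintegral_compl_ball_rpow_norm μ hR, ENNReal.mul_rpow_of_nonneg _ _ ha'.le,
      ENNReal.ofReal_rpow_of_nonneg (by positivity) ha'.le, ← Real.rpow_mul hR.le]
    have e : ((α - finrank ℝ E) / (1 - 1 / a) + finrank ℝ E) * (1 - 1 / a) = α - finrank ℝ E / a := by
      rw [add_mul, div_mul_cancel₀ _ ha'.ne']; ring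
    rw [e]
    refine (mul_le_mul_right (ENNReal.rpow_le_one hf1 (by positivity)) _).trans_eq (mul_one _)

theorem rieszPotential_level_le {α a c : ℝ} (ha : 1 < a) (hc : 0 < c) (μ : Measure E)
    [μ.IsAddHaarMeasure] (hac : (finrank ℝ E : ℝ) / c = finrank ℝ E / a - α) (hd : 0 < finrank ℝ E)
    {f : E → ℝ≥0∞} (hf : Measurable f) (hf1 : ∫⁻ y, f y ^ a ∂μ ≤ 1) {A B : ℝ≥0∞}
    (hA : A = ∫⁻ z, (ball (0 : E) 1).indicator
        (fun z => ENNReal.ofReal (‖z‖ ^ (α - finrank ℝ E))) z ∂μ)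
    (hB : B = (∫⁻ z, (ball (0 : E) 1)ᶜ.indicator
        (fun z => ENNReal.ofReal (‖z‖ ^ ((α - finrank ℝ E) / (1 - 1 / a)))) z ∂μ) ^ (1 - 1 / a))
    (hAt : A ≠ ∞) (hBt : B ≠ ∞) {s : ℝ} (hs : 0 < s) :
    μ {x | ENNReal.ofReal s < (∫⁻ y, ENNReal.ofReal (‖x - y‖ ^ (α - finrank ℝ E)) * f y ∂μ)
        / (A + B + 1)} ≤
      ENNReal.ofReal (s ^ (-(c / a))) * A *
        ∫⁻ y, {y | ENNReal.ofReal (s ^ (c / a)) < f y}.indicator f y ∂μ := by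
  set d : ℝ := (finrank ℝ E : ℝ) with hdd
  have hd0 : 0 < d := by rw [hdd]; exact_mod_cast hd
  set R : ℝ := s ^ (-(c / d)) with hRdef
  have hR : 0 < R := by positivity
  set L : ℝ≥0∞ := ENNReal.ofReal (s ^ (c / a)) with hL
  set K1 : E → ℝ≥0∞ := (ball (0 : E) R).indicator (fun z => ENNReal.ofReal (‖z‖ ^ (α - d))) with hK1
  set K2 : E → ℝ≥0∞ := (ball (0 : E) R)ᶜ.indicator (fun z => ENNReal.ofReal (‖z‖ ^ (α - d))) with hK2
  have mK1 : Measurable K1 := Measurable.indicator (by fun_prop) measurableSet_ball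
  have mK2 : Measurable K2 := Measurable.indicator (by fun_prop) measurableSet_ball.compl
  have mg : Measurable ({y | L < f y}.indicator f) := hf.indicator (measurableSet_lt measurable_const hf)
  have e1 : c * α / d + 1 = c / a := by
    have : d / c * (c / d) = 1 := by field_simp
    have h2 : (d / a - α) * (c / d) = 1 := by rw [← hac]; exact this
    have h3 : (d / a - α) * (c / d) = c / a - c * α / d := by field_simp
    linarith
  have eR1 : R ^ (α - d / a) = s := by
    have h : -(c / d) * (α - d / a) = 1 := by
      rw [show α - d / a = -(d / c) by rw [hac]; ring]; field_simp
    rw [hRdef, ← Real.rpow_mul hs.le, h, Real.rpow_one]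
  have eR2 : R ^ α * s ^ (c / a) = s := by
    rw [hRdef, ← Real.rpow_mul hs.le, ← Real.rpow_add hs, ← e1]
    rw [show -(c / d) * α + (c * α / d + 1) = 1 by ring, Real.rpow_one]
  have eR3 : R ^ α = s * s ^ (-(c / a)) := by
    nth_rewrite 1 [← eR2]
    rw [mul_assoc, ← Real.rpow_add hs, add_neg_cancel, Real.rpow_zero, mul_one]
  have pt : ∀ x, ∫⁻ y, ENNReal.ofReal (‖x - y‖ ^ (α - d)) * f y ∂μ ≤
      (A + B) * ENNReal.ofReal s + ∫⁻ y, K1 (x - y) * {y | L < f y}.indicator f y ∂μ := by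
    intro x
    calc ∫⁻ y, ENNReal.ofReal (‖x - y‖ ^ (α - d)) * f y ∂μ
        ≤ ∫⁻ y, (K1 (x - y) * L + K2 (x - y) * f y) + K1 (x - y) * {y | L < f y}.indicator f y ∂μ := by
          refine lintegral_mono fun y => ?_
          have hsplit : ENNReal.ofReal (‖x - y‖ ^ (α - d)) = K1 (x - y) + K2 (x - y) :=
            (congrFun (indicator_self_add_compl (ball (0 : E) R)
              (fun z => ENNReal.ofReal (‖z‖ ^ (α - d)))) (x - y)).symm
          have hfl : f y ≤ L + {y | L < f y}.indicator f y := by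
            by_cases h : L < f y
            · rw [indicator_of_mem (by exact h)]; exact le_add_self
            · exact (not_lt.1 h).trans le_self_add
          simp only []
          rw [hsplit, add_mul]
          calc _ ≤ K1 (x - y) * (L + {y | L < f y}.indicator f y) + K2 (x - y) * f y := by gcongr
            _ = _ := by ring
      _ = (∫⁻ y, K1 (x - y) * L ∂μ + ∫⁻ y, K2 (x - y) * f y ∂μ) +
          ∫⁻ y, K1 (x - y) * {y | L < f y}.indicator f y ∂μ := by
          rw [lintegral_add_left (by fun_prop), lintegral_add_left (by fun_prop)]
      _ ≤ _ := by
          gcongr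
          rw [add_mul]
          refine add_le_add (le_of_eq ?_) ?_
          · rw [hK1, hdd, lintegral_near_mul_const μ hR, ← hdd, ← hA, hL, mul_right_comm,
              ← ENNReal.ofReal_mul (by positivity), eR2, mul_comm]
          · refine (lintegral_far_mul_le ha μ hf hf1 hR x).trans_eq ?_
            rw [← hdd, eR1, ← hB, mul_comm]
  have mh : Measurable fun x => ∫⁻ y, K1 (x - y) * {y | L < f y}.indicator f y ∂μ :=
    Measurable.lintegral_prod_right (by fun_prop)
  have sub : {x | ENNReal.ofReal s < (∫⁻ y, ENNReal.ofReal (‖x - y‖ ^ (α - d)) * f y ∂μ)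
        / (A + B + 1)} ⊆
      {x | ENNReal.ofReal s ≤ ∫⁻ y, K1 (x - y) * {y | L < f y}.indicator f y ∂μ} := by
    intro x hx
    have hx' : ENNReal.ofReal s < (∫⁻ y, ENNReal.ofReal (‖x - y‖ ^ (α - d)) * f y ∂μ)
        / (A + B + 1) := hx
    rw [ENNReal.lt_div_iff_mul_lt (by simp) (by simp [hAt, hBt])] at hx'
    have h := hx'.le.trans (pt x)
    rw [mul_add, mul_one, mul_comm] at h
    exact (ENNReal.add_le_add_iff_left
      (ENNReal.mul_ne_top (ENNReal.add_ne_top.2 ⟨hAt, hBt⟩) ENNReal.ofReal_ne_top)).1 h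
  refine (measure_mono sub).trans ?_
  refine (meas_ge_le_lintegral_div mh.aemeasurable (by simpa using hs) ENNReal.ofReal_ne_top).trans ?_
  rw [hK1, hdd, lintegral_lintegral_near_mul μ mg hR, ← hdd, ← hA, eR3, ENNReal.ofReal_mul hs.le]
  refine ENNReal.div_le_of_le_mul' (le_of_eq ?_)
  ring

theorem hardyLittlewoodSobolev_of_le_one {α a c : ℝ} (ha : 1 < a) (hα : 0 < α) (hc : 0 < c)
    (μ : Measure E) [μ.IsAddHaarMeasure]
    (hac : (finrank ℝ E : ℝ) / c = finrank ℝ E / a - α) (hd : 0 < finrank ℝ E) :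
    ∃ C : ℝ≥0∞, C ≠ ∞ ∧ ∀ f : E → ℝ≥0∞, Measurable f → ∫⁻ y, f y ^ a ∂μ ≤ 1 →
      ∫⁻ x, (∫⁻ y, ENNReal.ofReal (‖x - y‖ ^ (α - finrank ℝ E)) * f y ∂μ) ^ c ∂μ ≤ C := by
  have hnt : Nontrivial E := Module.nontrivial_of_finrank_pos (R := ℝ) hd
  have hd0 : (0 : ℝ) < finrank ℝ E := by exact_mod_cast hd
  have ha' : 0 < 1 - 1 / a := by
    rw [sub_pos, div_lt_one (by linarith)]; exact ha
  obtain ⟨A, hA⟩ : ∃ A, A = ∫⁻ z, (ball (0 : E) 1).indicator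
        (fun z => ENNReal.ofReal (‖z‖ ^ (α - finrank ℝ E))) z ∂μ := ⟨_, rfl⟩
  obtain ⟨B, hB⟩ : ∃ B, B = (∫⁻ z, (ball (0 : E) 1)ᶜ.indicator
        (fun z => ENNReal.ofReal (‖z‖ ^ ((α - finrank ℝ E) / (1 - 1 / a)))) z ∂μ) ^ (1 - 1 / a) :=
    ⟨_, rfl⟩
  have hAt : A ≠ ∞ := by
    rw [hA]; exact lintegral_ball_one_rpow_norm_ne_top μ (by linarith)
  have hBt : B ≠ ∞ := by
    rw [hB]
    refine ENNReal.rpow_ne_top_of_nonneg ha'.le (lintegral_compl_ball_one_rpow_norm_ne_top μ ?_)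
    have : 0 < (finrank ℝ E : ℝ) / c := by positivity
    rw [div_lt_iff₀ ha']
    have : (finrank ℝ E : ℝ) * (1 / a) = finrank ℝ E / a := by ring
    nlinarith
  set e : ℝ := c - c / a with he
  have hepos : 0 < e := by rw [he, show c - c / a = c * (1 - 1 / a) by ring]; positivity
  refine ⟨(A + B + 1) ^ c * (ENNReal.ofReal c * (A * ENNReal.ofReal (1 / e))), ?_, fun f hf hf1 => ?_⟩
  · refine ENNReal.mul_ne_top (ENNReal.rpow_ne_top_of_nonneg hc.le (by simp [hAt, hBt])) ?_
    exact ENNReal.mul_ne_top ENNReal.ofReal_ne_top (ENNReal.mul_ne_top hAt ENNReal.ofReal_ne_top)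
  set F : E → ℝ≥0∞ := fun x =>
    (∫⁻ y, ENNReal.ofReal (‖x - y‖ ^ (α - finrank ℝ E)) * f y ∂μ) / (A + B + 1) with hF
  have mF : Measurable F := (Measurable.lintegral_prod_right (by fun_prop)).div_const _
  have hFx : ∀ x, ∫⁻ y, ENNReal.ofReal (‖x - y‖ ^ (α - finrank ℝ E)) * f y ∂μ = (A + B + 1) * F x :=
    fun x => (ENNReal.mul_div_cancel (by simp) (by simp [hAt, hBt])).symm
  simp_rw [hFx, ENNReal.mul_rpow_of_nonneg _ _ hc.le]
  rw [lintegral_const_mul _ (by fun_prop)]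
  refine mul_le_mul_right ?_ _
  have hpow : ∀ x, F x ^ c = ENNReal.ofReal c * ∫⁻ s in Ioi (0 : ℝ),
      {s : ℝ | ENNReal.ofReal s < F x}.indicator (fun s => ENNReal.ofReal (s ^ (c - 1))) s := by
    intro x
    rw [lintegral_rpow_indicator_lt hc, ← mul_assoc, ← ENNReal.ofReal_mul hc.le,
      mul_one_div_cancel hc.ne', ENNReal.ofReal_one, one_mul]
  have mind : ∀ (G : E → ℝ≥0∞) (φ : ℝ → ℝ) (w : E → ℝ → ℝ≥0∞), Measurable G → Measurable φ →
      Measurable (Function.uncurry w) →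
      Measurable (Function.uncurry fun (x : E) (s : ℝ) =>
        {s : ℝ | ENNReal.ofReal (φ s) < G x}.indicator (w x) s) := by
    intro G φ w hG hφ hw
    have : (Function.uncurry fun (x : E) (s : ℝ) =>
        {s : ℝ | ENNReal.ofReal (φ s) < G x}.indicator (w x) s) =
      {q : E × ℝ | ENNReal.ofReal (φ q.2) < G q.1}.indicator (Function.uncurry w) := by
      ext ⟨x, s⟩; simp [indicator]
    rw [this]
    exact hw.indicator (measurableSet_lt (by fun_prop) (by fun_prop))
  simp_rw [hpow]
  rw [lintegral_const_mul' _ _ ENNReal.ofReal_ne_top]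
  refine mul_le_mul_right ?_ _
  rw [lintegral_lintegral_swap
    (mind F (fun s => s) (fun _ s => ENNReal.ofReal (s ^ (c - 1))) mF measurable_id (by fun_prop)).aemeasurable]
  calc _ ≤ ∫⁻ s in Ioi (0 : ℝ), A * ∫⁻ y, {s : ℝ | ENNReal.ofReal (s ^ (c / a)) < f y}.indicator
        (fun s => f y * ENNReal.ofReal (s ^ (e - 1))) s ∂μ := by
        refine setLIntegral_mono' measurableSet_Ioi fun s hs => ?_
        have h1 : ∫⁻ x, {s : ℝ | ENNReal.ofReal s < F x}.indicator
            (fun s => ENNReal.ofReal (s ^ (c - 1))) s ∂μ =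
            ENNReal.ofReal (s ^ (c - 1)) * μ {x | ENNReal.ofReal s < F x} := by
          rw [← lintegral_indicator_const (measurableSet_lt measurable_const mF)]
          refine lintegral_congr fun x => ?_
          simp [indicator]
        rw [h1]
        refine (mul_le_mul_right (rieszPotential_level_le ha hc μ hac hd hf hf1 hA hB hAt hBt hs) _).trans
          (le_of_eq ?_)
        have h2 : ∫⁻ y, {s : ℝ | ENNReal.ofReal (s ^ (c / a)) < f y}.indicator
            (fun s => f y * ENNReal.ofReal (s ^ (e - 1))) s ∂μ =
            ENNReal.ofReal (s ^ (e - 1)) *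
              ∫⁻ y, {y | ENNReal.ofReal (s ^ (c / a)) < f y}.indicator f y ∂μ := by
          rw [← lintegral_const_mul _ (hf.indicator (measurableSet_lt measurable_const hf))]
          refine lintegral_congr fun y => ?_
          by_cases h : ENNReal.ofReal (s ^ (c / a)) < f y <;> simp [h, mul_comm]
        have hs' : (0 : ℝ) < s := hs
        rw [h2, he, show c - c / a - 1 = (c - 1) + -(c / a) by ring, Real.rpow_add hs',
          ENNReal.ofReal_mul (by positivity)]
        ring
    _ = A * ∫⁻ y, (f y * ∫⁻ s in Ioi (0 : ℝ), {s : ℝ | ENNReal.ofReal s < f y ^ (a / c)}.indicator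
        (fun s => ENNReal.ofReal (s ^ (e - 1))) s) ∂μ := by
        rw [lintegral_const_mul' _ _ hAt, lintegral_lintegral_swap
          (mind f (fun s => s ^ (c / a)) (fun y s => f y * ENNReal.ofReal (s ^ (e - 1))) hf
            (by fun_prop) (by fun_prop)).aemeasurable.prod_swap]
        congr 1
        refine lintegral_congr fun y => ?_
        rw [← lintegral_const_mul _ ((show Measurable fun s : ℝ => ENNReal.ofReal (s ^ (e - 1)) by
          fun_prop).indicator (measurableSet_lt (by fun_prop) measurable_const))]
        refine setLIntegral_congr_fun measurableSet_Ioi fun s hs => ?_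
        have hs' : (0 : ℝ) < s := hs
        have hiff : ENNReal.ofReal (s ^ (c / a)) < f y ↔ ENNReal.ofReal s < f y ^ (a / c) := by
          have hca : 0 < a / c := by positivity
          rw [← ENNReal.rpow_lt_rpow_iff hca, ENNReal.ofReal_rpow_of_pos (by positivity),
            ← Real.rpow_mul hs'.le, show c / a * (a / c) = 1 by field_simp, Real.rpow_one]
        by_cases h : ENNReal.ofReal s < f y ^ (a / c)
        · simp only [indicator, mem_ofPred_eq, hiff, h, if_true]
        · simp only [indicator, mem_ofPred_eq, hiff, h, if_false, mul_zero]
    _ = A * ENNReal.ofReal (1 / e) * ∫⁻ y, f y ^ a ∂μ := by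
        simp_rw [lintegral_rpow_indicator_lt hepos]
        rw [mul_assoc]
        congr 1
        rw [← lintegral_const_mul _ (by fun_prop)]
        refine lintegral_congr fun y => ?_
        rw [← ENNReal.rpow_mul,
          show a / c * e = a - 1 by rw [he]; field_simp, mul_left_comm]
        congr 1
        nth_rewrite 1 [← ENNReal.rpow_one (f y)]
        rw [← ENNReal.rpow_add_of_nonneg _ _ zero_le_one (by linarith), add_sub_cancel]
    _ ≤ A * ENNReal.ofReal (1 / e) := by
        exact (mul_le_mul_right hf1 _).trans_eq (mul_one _)

/-- The **Hardy-Littlewood-Sobolev inequality** for Riesz potentials of nonnegative functions. -/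
theorem hardyLittlewoodSobolev {α a c : ℝ} (ha : 1 < a) (hα : 0 < α) (hc : 0 < c)
    (μ : Measure E) [μ.IsAddHaarMeasure]
    (hac : (finrank ℝ E : ℝ) / c = finrank ℝ E / a - α) (hd : 0 < finrank ℝ E) :
    ∃ C : ℝ≥0∞, C ≠ ∞ ∧ ∀ f : E → ℝ≥0∞, Measurable f → ∫⁻ y, f y ^ a ∂μ ≠ ∞ →
      (∫⁻ x, (∫⁻ y, ENNReal.ofReal (‖x - y‖ ^ (α - finrank ℝ E)) * f y ∂μ) ^ c ∂μ) ^ (1 / c) ≤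
        C * (∫⁻ y, f y ^ a ∂μ) ^ (1 / a) := by
  obtain ⟨C, hC, h⟩ := hardyLittlewoodSobolev_of_le_one ha hα hc μ hac hd
  have ha0 : 0 < a := by linarith
  refine ⟨C ^ (1 / c), ENNReal.rpow_ne_top_of_nonneg (by positivity) hC, fun f hf hft => ?_⟩
  rcases eq_or_ne (∫⁻ y, f y ^ a ∂μ) 0 with h0 | h0
  · have hz : f =ᵐ[μ] 0 := by
      rw [lintegral_eq_zero_iff (by fun_prop)] at h0
      filter_upwards [h0] with y hy
      simpa [ha0, ha0.not_gt] using hy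
    have : ∀ x, ∫⁻ y, ENNReal.ofReal (‖x - y‖ ^ (α - finrank ℝ E)) * f y ∂μ = 0 := by
      intro x
      rw [lintegral_eq_zero_iff (by fun_prop)]
      filter_upwards [hz] with y hy
      simp [hy]
    simp [this, hc]
  set N := (∫⁻ y, f y ^ a ∂μ) ^ (1 / a) with hN
  have hN0 : N ≠ 0 := by
    rw [hN]; exact (ENNReal.rpow_pos (pos_iff_ne_zero.2 h0) hft).ne'
  have hNt : N ≠ ∞ := ENNReal.rpow_ne_top_of_nonneg (by positivity) hft
  have hNa : N ^ a = ∫⁻ y, f y ^ a ∂μ := by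
    rw [hN, ← ENNReal.rpow_mul, one_div_mul_cancel ha0.ne', ENNReal.rpow_one]
  have hg := h (fun y => N⁻¹ * f y) (by fun_prop) (by
    simp_rw [ENNReal.mul_rpow_of_nonneg _ _ ha0.le]
    rw [lintegral_const_mul _ (by fun_prop), ENNReal.inv_rpow, hNa, ENNReal.inv_mul_cancel h0 hft])
  simp_rw [mul_left_comm _ N⁻¹] at hg
  have hl : ∀ x, ∫⁻ y, N⁻¹ * (ENNReal.ofReal (‖x - y‖ ^ (α - finrank ℝ E)) * f y) ∂μ =
      N⁻¹ * ∫⁻ y, ENNReal.ofReal (‖x - y‖ ^ (α - finrank ℝ E)) * f y ∂μ := fun x =>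
    lintegral_const_mul _ (by fun_prop)
  simp_rw [hl, ENNReal.mul_rpow_of_nonneg _ _ hc.le] at hg
  rw [lintegral_const_mul _ ((Measurable.lintegral_prod_right (by fun_prop)).pow_const _)] at hg
  have hg' := ENNReal.rpow_le_rpow hg (show 0 ≤ 1 / c by positivity)
  rw [ENNReal.mul_rpow_of_nonneg _ _ (by positivity), ← ENNReal.rpow_mul,
    mul_one_div_cancel hc.ne', ENNReal.rpow_one, mul_comm, ← div_eq_mul_inv,
    ENNReal.div_le_iff hN0 hNt] at hg'
  exact hg'

end RieszPotential

section HardySobolev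

open Set Metric Module
open scoped ENNReal NNReal

theorem lintegral_rpow_mul_rpow_le {Ω : Type*} [MeasurableSpace Ω] {μ : Measure Ω}
    {g h : Ω → ℝ≥0∞} (hg : Measurable g) (hh : Measurable h) {r s a θ σ : ℝ} (hr : 0 < r)
    (hs : 0 < s) (ha : 0 < a) (hθ : 0 ≤ θ) (hσ : 0 ≤ σ) (hsum : θ / r + σ / s = 1 / a) :
    (∫⁻ x, (g x ^ θ * h x ^ σ) ^ a ∂μ) ^ (1 / a) ≤
      ((∫⁻ x, g x ^ r ∂μ) ^ (1 / r)) ^ θ * ((∫⁻ x, h x ^ s ∂μ) ^ (1 / s)) ^ σ := by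
  have key := ENNReal.lintegral_mul_norm_pow_le (μ := μ) (f := fun x => g x ^ r)
    (g := fun x => h x ^ s) (by fun_prop) (by fun_prop) (p := θ / r * a) (q := σ / s * a)
    (by positivity) (by positivity) (by rw [← add_mul, hsum, one_div_mul_cancel ha.ne'])
  have e : ∀ x, (g x ^ r) ^ (θ / r * a) * (h x ^ s) ^ (σ / s * a) = (g x ^ θ * h x ^ σ) ^ a := by
    intro x
    rw [ENNReal.mul_rpow_of_nonneg _ _ ha.le, ← ENNReal.rpow_mul, ← ENNReal.rpow_mul,
      ← ENNReal.rpow_mul, ← ENNReal.rpow_mul]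
    congr 2 <;> field_simp
  simp_rw [e] at key
  refine (ENNReal.rpow_le_rpow key (show 0 ≤ 1 / a by positivity)).trans_eq ?_
  rw [ENNReal.mul_rpow_of_nonneg _ _ (by positivity), ← ENNReal.rpow_mul, ← ENNReal.rpow_mul,
    ← ENNReal.rpow_mul, ← ENNReal.rpow_mul]
  congr 2 <;> field_simp

variable {E : Type*} [NormedAddCommGroup E] [NormedSpace ℝ E] [FiniteDimensional ℝ E]
  {F : Type*} [NormedAddCommGroup F] [NormedSpace ℝ F]

omit [FiniteDimensional ℝ E] in
theorem inv_norm_mul_enorm_le_lintegral_fderiv [CompleteSpace F] {u : E → F}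
    (hu : ContDiff ℝ 1 u) (h2u : HasCompactSupport u) (x : E) :
    ENNReal.ofReal ‖x‖⁻¹ * ‖u x‖ₑ ≤ ∫⁻ t in Ioi (1 : ℝ), ‖fderiv ℝ u (t • x)‖ₑ := by
  rcases eq_or_ne x 0 with rfl | hx
  · simp
  have hx0 : 0 < ‖x‖ := norm_pos_iff.2 hx
  have hφ : ContDiff ℝ 1 fun t : ℝ => u (t • x) := hu.comp (by fun_prop)
  have hφc : HasCompactSupport fun t : ℝ => u (t • x) :=
    h2u.comp_isClosedEmbedding (isClosedEmbedding_smul_left hx)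
  have h := hφc.integral_Ioi_deriv_eq hφ 1
  rw [one_smul] at h
  have hd : ∀ t : ℝ, ‖deriv (fun t : ℝ => u (t • x)) t‖ₑ ≤
      ENNReal.ofReal ‖x‖ * ‖fderiv ℝ u (t • x)‖ₑ := by
    intro t
    have h1 : HasDerivAt (fun t : ℝ => t • x) x t := by
      simpa using (hasDerivAt_id t).smul_const x
    have h2 := ((hu.differentiable one_ne_zero (t • x)).hasFDerivAt.comp_hasDerivAt t h1).deriv
    have h3 : deriv (fun t : ℝ => u (t • x)) t = fderiv ℝ u (t • x) x := h2
    rw [h3, mul_comm, ofReal_norm]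
    exact ContinuousLinearMap.le_opENorm _ _
  have h4 : ‖u x‖ₑ ≤ ENNReal.ofReal ‖x‖ * ∫⁻ t in Ioi (1 : ℝ), ‖fderiv ℝ u (t • x)‖ₑ := by
    rw [← enorm_neg, ← h, ← lintegral_const_mul' _ _ ENNReal.ofReal_ne_top]
    exact (enorm_integral_le_lintegral_enorm _).trans (lintegral_mono hd)
  refine (mul_le_mul_right h4 _).trans_eq ?_
  rw [← mul_assoc, ← ENNReal.ofReal_mul (by positivity), inv_mul_cancel₀ hx0.ne']
  simp

variable [MeasurableSpace E] [BorelSpace E] (μ : Measure E) [μ.IsAddHaarMeasure]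

/-- **Hardy's inequality** in `L^r`, for `1 < r < dim E`. -/
theorem hardy_inequality [CompleteSpace F] {r : ℝ} (hr : 1 < r) (hrd : r < finrank ℝ E) :
    ∃ C : ℝ≥0∞, C ≠ ∞ ∧ ∀ u : E → F, ContDiff ℝ 1 u → HasCompactSupport u →
      (∫⁻ x, (ENNReal.ofReal ‖x‖⁻¹ * ‖u x‖ₑ) ^ r ∂μ) ^ (1 / r) ≤
        C * (∫⁻ x, ‖fderiv ℝ u x‖ₑ ^ r ∂μ) ^ (1 / r) := by
  have hr0 : 0 < r := by linarith
  have hr' : 0 < 1 - 1 / r := by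
    rw [sub_pos, div_lt_one (by linarith)]; exact hr
  set d : ℝ := (finrank ℝ E : ℝ) with hd
  set b : ℝ := (r + d - 2) / (2 * r) with hb
  have hbr : b * r = (r + d - 2) / 2 := by rw [hb]; field_simp
  have fin : ∀ e : ℝ, e < -1 → ∫⁻ t in Ioi (1 : ℝ), ENNReal.ofReal (t ^ e) ≠ ∞ := by
    intro e he
    have h := (integrableOn_Ioi_rpow_of_lt he one_pos).hasFiniteIntegral
    rw [hasFiniteIntegral_iff_ofReal] at h
    · exact h.ne
    · filter_upwards [ae_restrict_mem measurableSet_Ioi] with t ht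
      exact Real.rpow_nonneg (zero_le_one.trans (le_of_lt ht)) _
  set M := ∫⁻ t in Ioi (1 : ℝ), ENNReal.ofReal (t ^ (-b / (1 - 1 / r))) with hM
  set N := ∫⁻ t in Ioi (1 : ℝ), ENNReal.ofReal (t ^ (b * r - d)) with hN
  have hMt : M ≠ ∞ := by
    refine fin _ ?_
    rw [div_lt_iff₀ hr']
    have : b * r > (1 - 1 / r) * r := by
      rw [hbr, sub_mul, one_div_mul_cancel hr0.ne']; linarith
    have := lt_of_mul_lt_mul_right this hr0.le
    linarith
  have hNt : N ≠ ∞ := fin _ (by rw [hbr]; linarith)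
  refine ⟨((M ^ (1 - 1 / r)) ^ r * N) ^ (1 / r), ?_, fun u hu h2u => ?_⟩
  · refine ENNReal.rpow_ne_top_of_nonneg (by positivity) (ENNReal.mul_ne_top ?_ hNt)
    exact ENNReal.rpow_ne_top_of_nonneg hr0.le (ENNReal.rpow_ne_top_of_nonneg hr'.le hMt)
  rw [← ENNReal.mul_rpow_of_nonneg _ _ (by positivity)]
  refine ENNReal.rpow_le_rpow ?_ (by positivity)
  have hDc : Continuous (fderiv ℝ u) := hu.continuous_fderiv one_ne_zero
  have pt : ∀ x, (ENNReal.ofReal ‖x‖⁻¹ * ‖u x‖ₑ) ^ r ≤ (M ^ (1 - 1 / r)) ^ r *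
      ∫⁻ t in Ioi (1 : ℝ), ENNReal.ofReal (t ^ (b * r)) * ‖fderiv ℝ u (t • x)‖ₑ ^ r := by
    intro x
    have hol := ENNReal.lintegral_mul_norm_pow_le (μ := volume.restrict (Ioi (1 : ℝ)))
      (f := fun t => ENNReal.ofReal (t ^ (-b / (1 - 1 / r))))
      (g := fun t => ENNReal.ofReal (t ^ (b * r)) * ‖fderiv ℝ u (t • x)‖ₑ ^ r)
      (by fun_prop) (by fun_prop) (p := 1 - 1 / r) (q := 1 / r) hr'.le (by positivity) (by ring)
    have e : ∫⁻ t in Ioi (1 : ℝ), ‖fderiv ℝ u (t • x)‖ₑ = ∫⁻ t in Ioi (1 : ℝ),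
        ENNReal.ofReal (t ^ (-b / (1 - 1 / r))) ^ (1 - 1 / r) *
        (ENNReal.ofReal (t ^ (b * r)) * ‖fderiv ℝ u (t • x)‖ₑ ^ r) ^ (1 / r) := by
      refine setLIntegral_congr_fun measurableSet_Ioi fun t ht => ?_
      have ht0 : (0 : ℝ) < t := zero_lt_one.trans ht
      rw [ENNReal.mul_rpow_of_nonneg _ _ (by positivity), ← ENNReal.rpow_mul,
        mul_one_div_cancel hr0.ne', ENNReal.rpow_one,
        ENNReal.ofReal_rpow_of_pos (by positivity), ENNReal.ofReal_rpow_of_pos (by positivity),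
        ← Real.rpow_mul ht0.le, ← Real.rpow_mul ht0.le, ← mul_assoc,
        ← ENNReal.ofReal_mul (by positivity), ← Real.rpow_add ht0, div_mul_cancel₀ _ hr'.ne',
        mul_assoc, mul_one_div_cancel hr0.ne', mul_one, neg_add_cancel, Real.rpow_zero,
        ENNReal.ofReal_one, one_mul]
    have h1 := (inv_norm_mul_enorm_le_lintegral_fderiv hu h2u x).trans (e.trans_le hol)
    refine (ENNReal.rpow_le_rpow h1 hr0.le).trans_eq ?_
    rw [ENNReal.mul_rpow_of_nonneg _ _ hr0.le, ← ENNReal.rpow_mul _ (1 / r),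
      one_div_mul_cancel hr0.ne', ENNReal.rpow_one]
  refine (lintegral_mono pt).trans_eq ?_
  have hne : (M ^ (1 - 1 / r)) ^ r ≠ ∞ :=
    ENNReal.rpow_ne_top_of_nonneg hr0.le (ENNReal.rpow_ne_top_of_nonneg hr'.le hMt)
  rw [lintegral_const_mul' _ _ hne, mul_assoc, lintegral_lintegral_swap (by fun_prop)]
  congr 1
  rw [hN, ← lintegral_mul_const _ (by fun_prop)]
  refine setLIntegral_congr_fun measurableSet_Ioi fun t ht => ?_
  have ht0 : (0 : ℝ) < t := zero_lt_one.trans ht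
  rw [lintegral_const_mul' _ _ ENNReal.ofReal_ne_top,
    lintegral_comp_smul_of_pos μ (fun x => ‖fderiv ℝ u x‖ₑ ^ r) ht0, ← mul_assoc,
    ← ENNReal.ofReal_mul (by positivity), ← Real.rpow_add ht0, ← hd, sub_eq_add_neg]

/-- The Gagliardo-Nirenberg-Sobolev inequality in terms of lower Lebesgue integrals. -/
theorem sobolev_lintegral [FiniteDimensional ℝ F] {r s : ℝ} (hr : 1 < r) (hs : 0 < s)
    (hd : 0 < finrank ℝ E) (hrs : 1 / s = 1 / r - 1 / finrank ℝ E) :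
    ∃ C : ℝ≥0∞, C ≠ ∞ ∧ ∀ u : E → F, ContDiff ℝ 1 u → HasCompactSupport u →
      (∫⁻ x, ‖u x‖ₑ ^ s ∂μ) ^ (1 / s) ≤ C * (∫⁻ x, ‖fderiv ℝ u x‖ₑ ^ r ∂μ) ^ (1 / r) := by
  lift r to ℝ≥0 using by linarith
  lift s to ℝ≥0 using hs.le
  refine ⟨SNormLESNormFDerivOfEqConst F μ r, ENNReal.coe_ne_top, fun u hu h2u => ?_⟩
  have h := eLpNorm_le_eLpNorm_fderiv_of_eq μ hu h2u (p := r) (p' := s)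
    (by exact_mod_cast hr.le) hd (by simpa using hrs)
  rw [eLpNorm_nnreal_eq_lintegral (by rintro rfl; simp at hs),
    eLpNorm_nnreal_eq_lintegral (by rintro rfl; norm_num at hr)] at h
  exact h

end HardySobolev

section NonlinearEstimate

open Module
open scoped ENNReal

/-- Trilinear estimate combining Hardy, Sobolev, Hölder and Hardy-Littlewood-Sobolev. -/
theorem lintegral_nonlinear_estimate {E : Type*} [NormedAddCommGroup E] [NormedSpace ℝ E]
    [FiniteDimensional ℝ E] [MeasurableSpace E] [BorelSpace E] (μ : Measure E)
    [μ.IsAddHaarMeasure] {F : Type*} [NormedAddCommGroup F] [NormedSpace ℝ F]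
    [FiniteDimensional ℝ F]
    {r s a b c q α θ σ : ℝ} (hr : 1 < r) (hrd : r < finrank ℝ E) (hs : 0 < s)
    (hrs : 1 / s = 1 / r - 1 / finrank ℝ E) (ha : 0 < a) (hb : 1 < b) (hc : 0 < c) (hq : 0 < q)
    (hα : 0 < α) (hθ : 0 ≤ θ) (hσ : 0 ≤ σ) (hsa : θ / r + σ / s = 1 / a)
    (hsb : (θ + 1) / r + σ / s = 1 / b) (hbc : (finrank ℝ E : ℝ) / c = finrank ℝ E / b - α)
    (hacq : 1 / a + 1 / c = 1 / q) :
    ∃ C : ℝ≥0∞, C ≠ ∞ ∧ ∀ u : E → F, ContDiff ℝ 1 u → HasCompactSupport u →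
      ∫⁻ x, ‖fderiv ℝ u x‖ₑ ^ r ∂μ ≠ ∞ →
      (∫⁻ x, (((ENNReal.ofReal ‖x‖⁻¹ * ‖u x‖ₑ) ^ θ * ‖u x‖ₑ ^ σ) *
        ∫⁻ y, ENNReal.ofReal (‖x - y‖ ^ (α - finrank ℝ E)) *
          ((ENNReal.ofReal ‖y‖⁻¹ * ‖u y‖ₑ) ^ (θ + 1) * ‖u y‖ₑ ^ σ) ∂μ) ^ q ∂μ) ^ (1 / q) ≤
      C * ((∫⁻ x, ‖fderiv ℝ u x‖ₑ ^ r ∂μ) ^ (1 / r)) ^ (2 * θ + 1 + 2 * σ) := by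
  have hr0 : 0 < r := by linarith
  have hd0 : (0 : ℝ) < finrank ℝ E := by linarith
  have hd : 0 < finrank ℝ E := by exact_mod_cast hd0
  have : CompleteSpace F := FiniteDimensional.complete ℝ F
  obtain ⟨H, hHt, hH⟩ := hardy_inequality (F := F) μ hr hrd
  obtain ⟨S, hSt, hS⟩ := sobolev_lintegral (F := F) μ hr hs hd hrs
  obtain ⟨K, hKt, hK⟩ := hardyLittlewoodSobolev hb hα hc μ hbc hd
  have hfin : ∀ ρ : ℝ, 0 ≤ ρ → H ^ ρ * S ^ σ ≠ ∞ := fun ρ hρ =>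
    ENNReal.mul_ne_top (ENNReal.rpow_ne_top_of_nonneg hρ hHt) (ENNReal.rpow_ne_top_of_nonneg hσ hSt)
  refine ⟨(H ^ θ * S ^ σ) * (K * (H ^ (θ + 1) * S ^ σ)), ENNReal.mul_ne_top (hfin _ hθ)
    (ENNReal.mul_ne_top hKt (hfin _ (by linarith))), fun u hu h2u hDt => ?_⟩
  have hu0 : Continuous u := hu.continuous
  set D := (∫⁻ x, ‖fderiv ℝ u x‖ₑ ^ r ∂μ) ^ (1 / r) with hD
  have hDt' : D ≠ ∞ := ENNReal.rpow_ne_top_of_nonneg (by positivity) hDt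
  set h : E → ℝ≥0∞ := fun x => ENNReal.ofReal ‖x‖⁻¹ * ‖u x‖ₑ with hh
  have mu : Measurable fun x => ‖u x‖ₑ := hu0.enorm.measurable
  have mh : Measurable h := by fun_prop
  have interp : ∀ ρ e : ℝ, 0 ≤ ρ → 0 < e → ρ / r + σ / s = 1 / e →
      (∫⁻ x, (h x ^ ρ * ‖u x‖ₑ ^ σ) ^ e ∂μ) ^ (1 / e) ≤ (H ^ ρ * S ^ σ) * D ^ (ρ + σ) := by
    intro ρ e hρ he hsum
    refine (lintegral_rpow_mul_rpow_le mh mu hr0 hs he hρ hσ hsum).trans ?_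
    refine (mul_le_mul' (ENNReal.rpow_le_rpow (hH u hu h2u) hρ)
      (ENNReal.rpow_le_rpow (hS u hu h2u) hσ)).trans_eq ?_
    rw [← hD, ENNReal.mul_rpow_of_nonneg _ _ hρ, ENNReal.mul_rpow_of_nonneg _ _ hσ,
      ENNReal.rpow_add_of_nonneg _ _ hρ hσ]
    ring
  set f1 : E → ℝ≥0∞ := fun x => h x ^ θ * ‖u x‖ₑ ^ σ with hf1
  set f2 : E → ℝ≥0∞ := fun x => h x ^ (θ + 1) * ‖u x‖ₑ ^ σ with hf2
  have mf1 : Measurable f1 := by fun_prop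
  have mf2 : Measurable f2 := by fun_prop
  have I1 := interp θ a hθ ha hsa
  have I2 := interp (θ + 1) b (by linarith) (by linarith) hsb
  have hf2t : ∫⁻ y, f2 y ^ b ∂μ ≠ ∞ := by
    intro htop
    have hb' : 0 < 1 / b := by positivity
    change (∫⁻ y, f2 y ^ b ∂μ) ^ (1 / b) ≤ _ at I2
    rw [htop, ENNReal.top_rpow_of_pos hb', top_le_iff] at I2
    exact ENNReal.mul_ne_top (hfin _ (by linarith))
      (ENNReal.rpow_ne_top_of_nonneg (by linarith) hDt') I2
  have mI : Measurable fun x => ∫⁻ y, ENNReal.ofReal (‖x - y‖ ^ (α - finrank ℝ E)) * f2 y ∂μ :=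
    Measurable.lintegral_prod_right (by fun_prop)
  have hol := lintegral_rpow_mul_rpow_le (μ := μ) mf1 mI ha hc hq zero_le_one zero_le_one hacq
  simp only [ENNReal.rpow_one] at hol
  refine hol.trans ((mul_le_mul' I1 ((hK f2 mf2 hf2t).trans (mul_le_mul_right I2 K))).trans_eq ?_)
  have hDadd : D ^ (2 * θ + 1 + 2 * σ) = D ^ (θ + σ) * D ^ (θ + 1 + σ) := by
    rw [← ENNReal.rpow_add_of_nonneg _ _ (by positivity) (by positivity)]
    ring_nf
  rw [hDadd]
  ring

theorem exists_exponents {n : ℕ} (hn : 3 ≤ n) {α τ p r : ℝ}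
    (hp : p = 1 + (2 - 2 * τ + α) / ((n : ℝ) - 2)) (hp2 : 2 < p) (hτ0 : 0 < τ) (hτp : τ ≤ p - 2)
    (hr1 : 1 < r) (hr : (n : ℝ) / r = (n : ℝ) / 2 - 1 / (2 * p - 1))
    (hrlow : 1 < (n : ℝ) / r) (hrhigh : (n : ℝ) / r < (p - τ - 1 + n) / p) :
    ∃ s a b c : ℝ, 0 < s ∧ 1 / s = 1 / r - 1 / n ∧ 0 < a ∧ 1 < b ∧ 0 < c ∧
      τ / r + (p - 1 - τ) / s = 1 / a ∧ (τ + 1) / r + (p - 1 - τ) / s = 1 / b ∧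
      (n : ℝ) / c = n / b - α ∧ 1 / a + 1 / c = 1 / (2 * (n : ℝ) / ((n : ℝ) + 2)) := by
  have hn3 : (3 : ℝ) ≤ n := by exact_mod_cast hn
  have hn0 : (0 : ℝ) < n := by linarith
  have hr0 : 0 < r := by linarith
  set N : ℝ := (n : ℝ) with hN
  set Q : ℝ := N / r with hQ
  set X : ℝ := 1 / (2 * p - 1) with hX
  have hX1 : X * (2 * p - 1) = 1 := one_div_mul_cancel (by linarith)
  have hX0 : 0 < X := by rw [hX]; apply one_div_pos.2; linarith
  have hp' : (p - 1) * (N - 2) = 2 - 2 * τ + α := by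
    rw [hp, add_sub_cancel_left, div_mul_cancel₀ _ (by linarith)]
  have hhigh : Q * p < p - τ - 1 + N := by rwa [lt_div_iff₀ (by linarith)] at hrhigh
  have hrQ : 1 / r = Q / N := by rw [hQ]; field_simp
  have hA : 0 < τ * Q + (p - 1 - τ) * (Q - 1) := by
    have : 0 < τ * Q := by positivity
    have : 0 < (p - 1 - τ) * (Q - 1) := mul_pos (by linarith) (by linarith)
    linarith
  have hB : 0 < (τ + 1) * Q + (p - 1 - τ) * (Q - 1) := by linarith
  have hCeq : (τ + 1) * Q + (p - 1 - τ) * (Q - 1) - α = N / 2 + 1 - α / 2 - p * X := by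
    rw [hr]; linear_combination (1 / 2) * hp'
  have hC : 0 < (τ + 1) * Q + (p - 1 - τ) * (Q - 1) - α := by
    rw [hCeq]; nlinarith
  refine ⟨N / (Q - 1), N / (τ * Q + (p - 1 - τ) * (Q - 1)),
    N / ((τ + 1) * Q + (p - 1 - τ) * (Q - 1)), N / ((τ + 1) * Q + (p - 1 - τ) * (Q - 1) - α),
    div_pos hn0 (by linarith), ?_, div_pos hn0 hA, ?_, div_pos hn0 hC, ?_, ?_, ?_, ?_⟩
  · rw [hrQ, one_div_div]; ring
  · rw [lt_div_iff₀ hB]; linarith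
  · rw [one_div_div, div_div_eq_mul_div, div_eq_mul_one_div τ r, hrQ]; ring
  · rw [one_div_div, div_div_eq_mul_div, div_eq_mul_one_div (τ + 1) r, hrQ]; ring
  · rw [div_div_cancel₀ hn0.ne', div_div_cancel₀ hn0.ne']
  · rw [one_div_div, one_div_div, one_div_div, ← add_div, hCeq, div_eq_div_iff hn0.ne' (by positivity),
      hr]
    linear_combination (2 * N) * ((1 / 2) * hp' - hX1)

theorem ofReal_weighted_rpow_mul {E F : Type*} [NormedAddCommGroup E] [NormedAddCommGroup F]
    {θ σ κ : ℝ} (hθ : 0 < θ) (hσ : 0 ≤ σ) (hκ : κ = θ + σ) (x : E) (v : F) :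
    ENNReal.ofReal (‖x‖ ^ (-θ) * ‖v‖ ^ κ) =
      (ENNReal.ofReal ‖x‖⁻¹ * ‖v‖ₑ) ^ θ * ‖v‖ₑ ^ σ := by
  rw [hκ, ENNReal.ofReal_mul (by positivity), Real.rpow_neg (norm_nonneg x),
    ← Real.inv_rpow (norm_nonneg x), Real.rpow_add_of_nonneg (norm_nonneg v) hθ.le hσ,
    ENNReal.ofReal_mul (by positivity), ← ENNReal.ofReal_rpow_of_nonneg (by positivity) hθ.le,
    ← ENNReal.ofReal_rpow_of_nonneg (by positivity) hθ.le,
    ← ENNReal.ofReal_rpow_of_nonneg (by positivity) hσ, ofReal_norm,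
    ENNReal.mul_rpow_of_nonneg _ _ hθ.le, mul_assoc]

end NonlinearEstimate

/-- Nonlinear estimate, term A₂ in Lemma 3.1:
`‖ |x|^{-τ} |u|^{p-1} (I_α * (|·|^{-τ-1}|u|^p)) ‖_{L^{2n/(n+2)}} ≤ C ‖∇u‖_{L^r}^{2p-1}`. -/
theorem nonlinear_estimate_A2 (n : ℕ) (hn : 3 ≤ n) (α τ p r : ℝ)
    (hα0 : 0 < α) (hαn : α < n) (hτ0 : 0 < τ)
    (hp : p = 1 + (2 - 2 * τ + α) / ((n : ℝ) - 2)) (hp2 : 2 < p) (hτp : τ ≤ p - 2)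
    (hr1 : 1 < r) (hr : (n : ℝ) / r = (n : ℝ) / 2 - 1 / (2 * p - 1))
    (hrlow : 1 < (n : ℝ) / r)
    (hrhigh : (n : ℝ) / r < min ((p - τ - 2 + n) / (p - 1)) ((p - τ - 1 + n) / p)) :
    ∃ C : ℝ, 0 < C ∧ ∀ u : EuclideanSpace ℝ (Fin n) → ℂ,
      ContDiff ℝ (⊤ : ℕ∞) u → HasCompactSupport u →
      (∫ x, (‖x‖ ^ (-τ) * ‖u x‖ ^ (p - 1)
              * ∫ y, ‖x - y‖ ^ (α - (n : ℝ)) * (‖y‖ ^ (-τ - 1) * ‖u y‖ ^ p))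
            ^ (2 * (n : ℝ) / ((n : ℝ) + 2))) ^ (((n : ℝ) + 2) / (2 * (n : ℝ)))
        ≤ C * ((∫ x, ‖fderiv ℝ u x‖ ^ r) ^ (1 / r)) ^ (2 * p - 1) := by
  have hn3 : (3 : ℝ) ≤ n := by exact_mod_cast hn
  have hn0 : (0 : ℝ) < n := by linarith
  have hr0 : 0 < r := by linarith
  have hfr : Module.finrank ℝ (EuclideanSpace ℝ (Fin n)) = n := finrank_euclideanSpace_fin
  obtain ⟨s, a, b, c, hs, hrs, ha, hb, hc, hsa, hsb, hbc, hacq⟩ := exists_exponents hn hp hp2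
    hτ0 hτp hr1 hr hrlow (hrhigh.trans_le (min_le_right _ _))
  set q : ℝ := 2 * (n : ℝ) / ((n : ℝ) + 2) with hq
  have hq0 : 0 < q := by positivity
  have hqi : ((n : ℝ) + 2) / (2 * (n : ℝ)) = 1 / q := by rw [hq, one_div_div]
  have hrn : r < n := by rwa [one_lt_div hr0] at hrlow
  have hσ : 0 ≤ p - 1 - τ := by linarith
  obtain ⟨K, hKt, hK⟩ := lintegral_nonlinear_estimate
    (volume : Measure (EuclideanSpace ℝ (Fin n))) (F := ℂ) hr1 (by rwa [hfr]) hs (by rwa [hfr]) ha hb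
    hc hq0 hα0 hτ0.le hσ hsa hsb (by rwa [hfr]) hacq
  rw [hfr] at hK
  refine ⟨K.toReal + 1, by positivity, fun u hu h2u => ?_⟩
  have hu1 : ContDiff ℝ 1 u := hu.of_le (by exact_mod_cast le_top)
  have hDc : Continuous (fderiv ℝ u) := hu1.continuous_fderiv one_ne_zero
  have hint : Integrable fun x => ‖fderiv ℝ u x‖ ^ r := by
    refine (hDc.norm.rpow_const fun _ => Or.inr hr0.le).integrable_of_hasCompactSupport ?_
    exact (h2u.fderiv ℝ).comp_left (g := fun L => ‖L‖ ^ r) (by simp [hr0.ne'])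
  have hD : ∫⁻ x, ‖fderiv ℝ u x‖ₑ ^ r = ENNReal.ofReal (∫ x, ‖fderiv ℝ u x‖ ^ r) := by
    rw [ofReal_integral_eq_lintegral_ofReal hint (Filter.Eventually.of_forall fun x => by positivity)]
    refine lintegral_congr fun x => ?_
    rw [← ENNReal.ofReal_rpow_of_nonneg (norm_nonneg _) hr0.le, ofReal_norm]
  have hI0 : 0 ≤ ∫ x, ‖fderiv ℝ u x‖ ^ r := integral_nonneg fun x => by positivity
  have hest := hK u hu1 h2u (by rw [hD]; exact ENNReal.ofReal_ne_top)
  set D : ℝ := (∫ x, ‖fderiv ℝ u x‖ ^ r) ^ (1 / r) with hDdef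
  have hD0 : 0 ≤ D := by positivity
  rw [hD, ENNReal.ofReal_rpow_of_nonneg hI0 (by positivity), ← hDdef,
    show 2 * τ + 1 + 2 * (p - 1 - τ) = 2 * p - 1 by ring,
    ENNReal.ofReal_rpow_of_nonneg hD0 (by linarith)] at hest
  rw [hqi]
  have hΨ0 : ∀ x, 0 ≤ ∫ y, ‖x - y‖ ^ (α - (n : ℝ)) * (‖y‖ ^ (-τ - 1) * ‖u y‖ ^ p) := fun x =>
    integral_nonneg fun y => by positivity
  have hΦ0 : ∀ x, 0 ≤ ‖x‖ ^ (-τ) * ‖u x‖ ^ (p - 1) *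
      ∫ y, ‖x - y‖ ^ (α - (n : ℝ)) * (‖y‖ ^ (-τ - 1) * ‖u y‖ ^ p) := fun x =>
    mul_nonneg (by positivity) (hΨ0 x)
  have hinner : ∀ x, ENNReal.ofReal
      (∫ y, ‖x - y‖ ^ (α - (n : ℝ)) * (‖y‖ ^ (-τ - 1) * ‖u y‖ ^ p)) ≤
      ∫⁻ y, ENNReal.ofReal (‖x - y‖ ^ (α - (n : ℝ))) *
        ((ENNReal.ofReal ‖y‖⁻¹ * ‖u y‖ₑ) ^ (τ + 1) * ‖u y‖ₑ ^ (p - 1 - τ)) := by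
    intro x
    rw [← Real.enorm_of_nonneg (hΨ0 x)]
    refine (enorm_integral_le_lintegral_enorm _).trans_eq (lintegral_congr fun y => ?_)
    rw [Real.enorm_of_nonneg (by positivity), ENNReal.ofReal_mul (by positivity),
      show -τ - 1 = -(τ + 1) by ring,
      ofReal_weighted_rpow_mul (σ := p - 1 - τ) (by linarith) hσ (by ring)]
  have hpt : ∀ x, ‖(‖x‖ ^ (-τ) * ‖u x‖ ^ (p - 1) *
      ∫ y, ‖x - y‖ ^ (α - (n : ℝ)) * (‖y‖ ^ (-τ - 1) * ‖u y‖ ^ p)) ^ q‖ₑ ≤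
      (((ENNReal.ofReal ‖x‖⁻¹ * ‖u x‖ₑ) ^ τ * ‖u x‖ₑ ^ (p - 1 - τ)) *
        ∫⁻ y, ENNReal.ofReal (‖x - y‖ ^ (α - (n : ℝ))) *
          ((ENNReal.ofReal ‖y‖⁻¹ * ‖u y‖ₑ) ^ (τ + 1) * ‖u y‖ₑ ^ (p - 1 - τ))) ^ q := by
    intro x
    rw [Real.enorm_of_nonneg (Real.rpow_nonneg (hΦ0 x) q),
      ← ENNReal.ofReal_rpow_of_nonneg (hΦ0 x) hq0.le]
    refine ENNReal.rpow_le_rpow ?_ hq0.le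
    rw [ENNReal.ofReal_mul (by positivity),
      ofReal_weighted_rpow_mul (σ := p - 1 - τ) hτ0 hσ (by ring)]
    exact mul_le_mul_right (hinner x) _
  have hX0 : 0 ≤ ∫ x, (‖x‖ ^ (-τ) * ‖u x‖ ^ (p - 1) *
      ∫ y, ‖x - y‖ ^ (α - (n : ℝ)) * (‖y‖ ^ (-τ - 1) * ‖u y‖ ^ p)) ^ q :=
    integral_nonneg fun x => Real.rpow_nonneg (hΦ0 x) q
  rw [← ENNReal.ofReal_le_ofReal_iff (by positivity), ← ENNReal.ofReal_rpow_of_nonneg hX0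
    (by positivity), ← Real.enorm_of_nonneg hX0]
  refine (ENNReal.rpow_le_rpow ((enorm_integral_le_lintegral_enorm _).trans (lintegral_mono hpt))
    (by positivity)).trans (hest.trans ?_)
  rw [ENNReal.ofReal_mul (by positivity)]
  refine mul_le_mul_left ?_ _
  exact ENNReal.le_ofReal_iff_toReal_le hKt (by positivity) |>.2 (by linarith)
end

section
/- (Quantitative coercivity underlying Lemma 5.1.) Let p > 1, P > 0, 0 ≤ c < 1 be real numbers, and let a, b ≥ 0 satisfy b ≤ P^{1−p} a^p and b ≤ c P. Then a − b/p ≥ (1 − c^{(p−1)/p}/p) a. In particular, since 1 − c^{(p−1)/p}/p > 0, a ≤ (1 − c^{(p−1)/p}/p)^{−1} (a − b/p). -/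
/-- Interpolating a superlinear bound on `b` with a level bound gives a linear bound. -/
theorem le_rpow_mul_of_le_rpow_mul_rpow {p P c a b : ℝ}
    (hp : 1 < p) (hP : 0 < P) (hc : 0 ≤ c) (ha : 0 ≤ a) (hb : 0 ≤ b)
    (hGN : b ≤ P ^ (1 - p) * a ^ p) (hbc : b ≤ c * P) :
    b ≤ c ^ ((p - 1) / p) * a := by
  have hp0 : 0 < p := by linarith
  have hθ : 0 ≤ (p - 1) / p := div_nonneg (by linarith) hp0.le
  calc
    b = b ^ ((p - 1) / p) * b ^ (1 / p) := by
      rw [← Real.rpow_add_of_nonneg hb hθ (by positivity), ← add_div, sub_add_cancel,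
        div_self hp0.ne', Real.rpow_one]
    _ ≤ (c * P) ^ ((p - 1) / p) * (P ^ (1 - p) * a ^ p) ^ (1 / p) := by gcongr
    _ = c ^ ((p - 1) / p) * (P ^ ((p - 1) / p) * P ^ ((1 - p) * (1 / p))) * a := by
      rw [Real.mul_rpow hc hP.le, Real.mul_rpow (by positivity) (by positivity),
        ← Real.rpow_mul hP.le, ← Real.rpow_mul ha, mul_one_div_cancel hp0.ne', Real.rpow_one]
      ring
    _ = c ^ ((p - 1) / p) * a := by
      rw [← Real.rpow_add hP, show (p - 1) / p + (1 - p) * (1 / p) = 0 by ring,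
        Real.rpow_zero, mul_one]

/-- Quantitative coercivity underlying Lemma 5.1 (energy trapping):
if `b ≤ P^{1-p} a^p` and `b ≤ c P` with `0 ≤ c < 1`, then
`a - b/p ≥ (1 - c^{(p-1)/p}/p) a`, and consequently
`a ≤ (1 - c^{(p-1)/p}/p)⁻¹ (a - b/p)`. -/
theorem coercivity_energy_trapping (p P c a b : ℝ)
    (hp : 1 < p) (hP : 0 < P) (hc0 : 0 ≤ c) (hc1 : c < 1)
    (ha : 0 ≤ a) (hb : 0 ≤ b)
    (hGN : b ≤ P ^ (1 - p) * a ^ p) (hbc : b ≤ c * P) :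
    a - b / p ≥ (1 - c ^ ((p - 1) / p) / p) * a ∧
    a ≤ (1 - c ^ ((p - 1) / p) / p)⁻¹ * (a - b / p) := by
  have hp0 : 0 < p := by linarith
  have hcoer : (1 - c ^ ((p - 1) / p) / p) * a ≤ a - b / p := by
    have h := div_le_div_of_nonneg_right
      (le_rpow_mul_of_le_rpow_mul_rpow hp hP hc0 ha hb hGN hbc) hp0.le
    rw [mul_div_right_comm] at h
    linarith
  have hpos : 0 < 1 - c ^ ((p - 1) / p) / p := by
    have hle : c ^ ((p - 1) / p) ≤ 1 :=
      Real.rpow_le_one hc0 hc1.le (div_nonneg (by linarith) hp0.le)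
    rw [sub_pos, div_lt_one hp0]
    linarith
  exact ⟨hcoer, (le_inv_mul_iff₀ hpos).2 hcoer⟩
end

section
/- (Equivalence of the Ḣ¹_λ and Ḣ¹ norms, via the sharp Hardy inequality.) Let n ≥ 3 and λ > −(n−2)²/4. Then there exist constants c, C > 0 such that for every u ∈ C_c^∞(ℝⁿ, ℂ), c ∫_{ℝⁿ} |∇u|² dx ≤ ∫_{ℝⁿ} |∇u|² dx + λ ∫_{ℝⁿ} |u(x)|²/|x|² dx ≤ C ∫_{ℝⁿ} |∇u|² dx. -/
open MeasureTheory

open Filter Topology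

/-- Testing a compactly supported `C¹` function against the Euler vector field `x ↦ x`. -/
theorem integral_fderiv_apply_self {n : ℕ} {f : EuclideanSpace ℝ (Fin n) → ℝ}
    (hf : ContDiff ℝ 1 f) (hs : HasCompactSupport f) :
    ∫ x, fderiv ℝ f x x = -(n * ∫ x, f x) := by
  let b := EuclideanSpace.basisFun (Fin n) ℝ
  have hdf : Continuous (fderiv ℝ f) := hf.continuous_fderiv one_ne_zero
  have hint (i : Fin n) : Integrable fun x => x i * fderiv ℝ f x (b i) := by
    refine Continuous.integrable_of_hasCompactSupport (by fun_prop) ?_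
    exact (hs.fderiv_apply ℝ (b i)).mul_left
  have hcoord (i : Fin n) (x : EuclideanSpace ℝ (Fin n)) :
      fderiv ℝ (fun y : EuclideanSpace ℝ (Fin n) => y i) x (b i) = 1 := by
    rw [show (fun y : EuclideanSpace ℝ (Fin n) => y i) = EuclideanSpace.proj (𝕜 := ℝ) i from rfl,
      ContinuousLinearMap.fderiv]
    simp [b]
  have hparts (i : Fin n) : ∫ x, x i * fderiv ℝ f x (b i) = -∫ x, f x := by
    have h := integral_mul_fderiv_eq_neg_fderiv_mul_of_integrable (μ := volume)
      (f := fun y : EuclideanSpace ℝ (Fin n) => y i) (g := f) (v := b i)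
      (by simpa only [hcoord, one_mul] using hf.continuous.integrable_of_hasCompactSupport hs)
      (hint i)
      (Continuous.integrable_of_hasCompactSupport
        (by have := hf.continuous; fun_prop) hs.mul_left)
      (fun x _ => by fun_prop) (fun x _ => hf.differentiable one_ne_zero x)
    simpa only [hcoord, one_mul] using h
  have hsum (x : EuclideanSpace ℝ (Fin n)) :
      fderiv ℝ f x x = ∑ i, x i * fderiv ℝ f x (b i) := by
    have h := congrArg (fderiv ℝ f x) (b.sum_repr x)
    rw [map_sum] at h
    simpa [b] using h.symm
  simp_rw [hsum]
  rw [integral_finsetSum _ fun i _ => hint i]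
  simp [hparts]

section Hardy

variable {F : Type*} [NormedAddCommGroup F] [InnerProductSpace ℝ F]

/-- Pointwise estimate behind the regularized Hardy inequality. -/
theorem neg_fderiv_normSq_div_apply_self_le {E : Type*} [NormedAddCommGroup E]
    [InnerProductSpace ℝ E] {u : E → F} {x : E} (hu : DifferentiableAt ℝ u x) {ε m : ℝ}
    (hε : 0 < ε) (hm : 0 < m) :
    -fderiv ℝ (fun y => ‖u y‖ ^ 2 / (‖y‖ ^ 2 + ε)) x x ≤
      (2 + m / 2) * (‖u x‖ ^ 2 / (‖x‖ ^ 2 + ε)) + 2 / m * ‖fderiv ℝ u x‖ ^ 2 := by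
  set f : E → ℝ := fun y => ‖u y‖ ^ 2 / (‖y‖ ^ 2 + ε) with hf_def
  have hρ (y : E) : 0 < ‖y‖ ^ 2 + ε := by positivity
  have hf : DifferentiableAt ℝ f x := by
    simp only [hf_def, div_eq_mul_inv]
    exact (hu.norm_sq ℝ).mul (((differentiableAt_id.norm_sq ℝ).add_const ε).inv (hρ x).ne')
  have hprod := hf.hasFDerivAt.mul ((hasFDerivAt_id (𝕜 := ℝ) x).norm_sq.add_const ε)
  have hnum := hu.hasFDerivAt.norm_sq
  have heq : f * (fun y => ‖id y‖ ^ 2 + ε) = fun y => ‖u y‖ ^ 2 := by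
    funext y
    simp [hf_def, div_mul_cancel₀ _ (hρ y).ne']
  have key := DFunLike.congr_fun ((heq ▸ hprod).unique hnum) x
  simp at key
  have hcs : |inner ℝ (u x) (fderiv ℝ u x x)| ≤ ‖u x‖ * (‖fderiv ℝ u x‖ * ‖x‖) :=
    (abs_real_inner_le_norm _ _).trans (by gcongr; exact (fderiv ℝ u x).le_opNorm x)
  have hfx : f x * (‖x‖ ^ 2 + ε) = ‖u x‖ ^ 2 := div_mul_cancel₀ _ (hρ x).ne'
  have hf0 : 0 ≤ f x := by positivity
  change -fderiv ℝ f x x ≤ (2 + m / 2) * f x + 2 / m * ‖fderiv ℝ u x‖ ^ 2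
  refine le_of_mul_le_mul_left ?_ (hρ x)
  have hyoung : 2 * (‖u x‖ * (‖fderiv ℝ u x‖ * ‖x‖)) ≤
      m / 2 * ‖u x‖ ^ 2 + 2 / m * (‖fderiv ℝ u x‖ ^ 2 * ‖x‖ ^ 2) := by
    have h : 0 ≤ 2 / m * (‖fderiv ℝ u x‖ * ‖x‖ - m / 2 * ‖u x‖) ^ 2 := by positivity
    have e : 2 / m * (‖fderiv ℝ u x‖ * ‖x‖ - m / 2 * ‖u x‖) ^ 2 =
        m / 2 * ‖u x‖ ^ 2 + 2 / m * (‖fderiv ℝ u x‖ ^ 2 * ‖x‖ ^ 2) -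
          2 * (‖u x‖ * (‖fderiv ℝ u x‖ * ‖x‖)) := by
      field_simp
      ring
    linarith
  have hfε : 0 ≤ f x * ε := by positivity
  have hdε : 0 ≤ 2 / m * ‖fderiv ℝ u x‖ ^ 2 * ε := by positivity
  have hlow := (abs_le.1 hcs).1
  rw [← hfx] at hyoung
  linarith

/-- Hardy's inequality with the weight `1 / |x|²` replaced by `1 / (|x|² + ε)`. -/
theorem hardy_inequality_regularized {n : ℕ} (hn : 2 < n) {u : EuclideanSpace ℝ (Fin n) → F}
    (hu : ContDiff ℝ 1 u) (hs : HasCompactSupport u) {ε : ℝ} (hε : 0 < ε) :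
    ((n : ℝ) - 2) ^ 2 / 4 * ∫ x, ‖u x‖ ^ 2 / (‖x‖ ^ 2 + ε) ≤ ∫ x, ‖fderiv ℝ u x‖ ^ 2 := by
  have hm : (0 : ℝ) < n - 2 := by
    have : (2 : ℝ) < n := by exact_mod_cast hn
    linarith
  set f : EuclideanSpace ℝ (Fin n) → ℝ := fun y => ‖u y‖ ^ 2 / (‖y‖ ^ 2 + ε) with hf_def
  have hf : ContDiff ℝ 1 f :=
    (hu.norm_sq ℝ).div ((contDiff_id.norm_sq ℝ).add contDiff_const) fun x => by positivity
  have hfs : HasCompactSupport f :=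
    hs.mono fun x hx hux => hx (by simp [hf_def, hux])
  have hfi : Integrable f := hf.continuous.integrable_of_hasCompactSupport hfs
  have hdi : Integrable fun x => ‖fderiv ℝ u x‖ ^ 2 := by
    have := hu.continuous_fderiv one_ne_zero
    refine Continuous.integrable_of_hasCompactSupport (by fun_prop) ?_
    exact (hs.fderiv ℝ).mono fun x hx hux => hx (by simp [hux])
  have hEi : Integrable fun x => fderiv ℝ f x x := by
    have := hf.continuous_fderiv one_ne_zero
    refine Continuous.integrable_of_hasCompactSupport (by fun_prop) ?_
    exact (hfs.fderiv ℝ).mono fun x hx hux => hx (by simp [hux])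
  have h := integral_mono hEi.neg
    ((hfi.const_mul (2 + (n - 2 : ℝ) / 2)).add (hdi.const_mul (2 / (n - 2 : ℝ))))
    fun x => neg_fderiv_normSq_div_apply_self_le (hu.differentiable one_ne_zero x) hε hm
  simp only [Pi.neg_apply, Pi.add_apply] at h
  rw [integral_neg, integral_fderiv_apply_self hf hfs,
    integral_add (hfi.const_mul _) (hdi.const_mul _), integral_const_mul, integral_const_mul] at h
  set I := ∫ x, f x
  set G := ∫ x, ‖fderiv ℝ u x‖ ^ 2
  have h' : ((n : ℝ) - 2) / 2 * I ≤ 2 / (n - 2) * G := by linarith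
  calc ((n : ℝ) - 2) ^ 2 / 4 * I = (n - 2) / 2 * ((n - 2) / 2 * I) := by ring
    _ ≤ (n - 2) / 2 * (2 / (n - 2) * G) := by gcongr
    _ = G := by field_simp

/-- Hardy's inequality, in the weak form where the left-hand side is `0` if
`|u|² / |x|²` is not integrable. -/
theorem hardy_inequality_s19 {n : ℕ} (hn : 2 < n) {u : EuclideanSpace ℝ (Fin n) → F}
    (hu : ContDiff ℝ 1 u) (hs : HasCompactSupport u) :
    ((n : ℝ) - 2) ^ 2 / 4 * ∫ x, ‖u x‖ ^ 2 / ‖x‖ ^ 2 ≤ ∫ x, ‖fderiv ℝ u x‖ ^ 2 := by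
  by_cases hi : Integrable fun x : EuclideanSpace ℝ (Fin n) => ‖u x‖ ^ 2 / ‖x‖ ^ 2
  swap
  · rw [integral_undef hi, mul_zero]
    positivity
  have : Nonempty (Fin n) := ⟨⟨0, by omega⟩⟩
  have hne : ∀ᵐ x : EuclideanSpace ℝ (Fin n), x ≠ 0 := by
    simp [ae_iff]
  have hcont := hu.continuous
  have hlim : Tendsto (fun ε : ℝ => ∫ x, ‖u x‖ ^ 2 / (‖x‖ ^ 2 + ε)) (𝓝[>] 0)
      (𝓝 (∫ x, ‖u x‖ ^ 2 / ‖x‖ ^ 2)) := by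
    refine tendsto_integral_filter_of_dominated_convergence
      (fun x => ‖u x‖ ^ 2 / ‖x‖ ^ 2) ?_ ?_ hi ?_
    · filter_upwards [self_mem_nhdsWithin] with ε (hε : 0 < ε)
      refine Continuous.aestronglyMeasurable ?_
      exact (by fun_prop : Continuous fun x => ‖u x‖ ^ 2).div (by fun_prop)
        fun x => by positivity
    · filter_upwards [self_mem_nhdsWithin] with ε (hε : 0 < ε)
      filter_upwards [hne] with x hx
      have := norm_pos_iff.2 hx
      rw [Real.norm_of_nonneg (by positivity)]
      gcongr
      linarith
    · filter_upwards [hne] with x hx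
      have hx' : ‖x‖ ^ 2 + 0 ≠ 0 := by simpa using hx
      have : ContinuousAt (fun ε : ℝ => ‖u x‖ ^ 2 / (‖x‖ ^ 2 + ε)) 0 :=
        continuousAt_const.div (by fun_prop) hx'
      simpa using this.tendsto.mono_left nhdsWithin_le_nhds
  refine le_of_tendsto (hlim.const_mul _) ?_
  filter_upwards [self_mem_nhdsWithin] with ε hε
  exact hardy_inequality_regularized hn hu hs hε

end Hardy

/-- Equivalence of the `Ḣ¹_λ` and `Ḣ¹` norms via the sharp Hardy inequality:
for `λ > -(n-2)²/4`, `c ‖∇u‖² ≤ ‖∇u‖² + λ‖u/|x|‖² ≤ C ‖∇u‖²`. -/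
theorem sobolev_norm_equivalence (n : ℕ) (hn : 3 ≤ n) (lam : ℝ)
    (hlam : -(((n : ℝ) - 2) ^ 2 / 4) < lam) :
    ∃ c C : ℝ, 0 < c ∧ 0 < C ∧ ∀ u : EuclideanSpace ℝ (Fin n) → ℂ,
      ContDiff ℝ (⊤ : ℕ∞) u → HasCompactSupport u →
      c * (∫ x, ‖fderiv ℝ u x‖ ^ 2)
          ≤ (∫ x, ‖fderiv ℝ u x‖ ^ 2) + lam * ∫ x, ‖u x‖ ^ 2 / ‖x‖ ^ 2 ∧
      (∫ x, ‖fderiv ℝ u x‖ ^ 2) + lam * ∫ x, ‖u x‖ ^ 2 / ‖x‖ ^ 2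
          ≤ C * ∫ x, ‖fderiv ℝ u x‖ ^ 2 := by
  have hm : (0 : ℝ) < n - 2 := by
    have : (3 : ℝ) ≤ n := by exact_mod_cast hn
    linarith
  set k : ℝ := ((n : ℝ) - 2) ^ 2 / 4 with hk_def
  have hk : 0 < k := by positivity
  have hlk : 0 < 1 + lam / k := by
    have : -1 < lam / k := by rw [lt_div_iff₀ hk]; linarith
    linarith
  refine ⟨min 1 (1 + lam / k), 1 + |lam| / k, lt_min one_pos hlk, by positivity,
    fun u hu hs => ?_⟩
  have hardy := hardy_inequality_s19 (by omega) (hu.of_le (by simp)) hs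
  rw [← hk_def] at hardy
  have hH : 0 ≤ ∫ x, ‖u x‖ ^ 2 / ‖x‖ ^ 2 := by positivity
  have hG : 0 ≤ ∫ x, ‖fderiv ℝ u x‖ ^ 2 := by positivity
  set H := ∫ x, ‖u x‖ ^ 2 / ‖x‖ ^ 2
  set G := ∫ x, ‖fderiv ℝ u x‖ ^ 2
  have hHG : H ≤ G / k := by rwa [le_div_iff₀' hk]
  constructor
  · rcases le_total 0 lam with h | h
    · calc min 1 (1 + lam / k) * G ≤ 1 * G := by gcongr; exact min_le_left _ _
        _ ≤ G + lam * H := by have := mul_nonneg h hH; linarith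
    · calc min 1 (1 + lam / k) * G ≤ (1 + lam / k) * G := by gcongr; exact min_le_right _ _
        _ = G + lam * (G / k) := by ring
        _ ≤ G + lam * H := by have := mul_le_mul_of_nonpos_left hHG h; linarith
  · calc G + lam * H ≤ G + |lam| * (G / k) := by gcongr; exact le_abs_self lam
      _ = (1 + |lam| / k) * G := by ring
end
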